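/- arXiv:2407.10665 — 3 statements merged into one kernel-verified Lean document; each statement's English description precedes it below -/
import Mathlib

section
/- Let Ω ⊆ ℝ^d be a nonempty open set, let H = Σ_{|α|≤m} c_α D^α be an m-th order constant-coefficient operator (m ≥ 2) whose symbol satisfies |P(ξ) − |ξ|^m| ≤ C₀ |ξ|^{m−1} for all |ξ| ≥ 1, and let V ∈ C^∞(Ω, ℂ). Let x ∈ Ω and r ∈ (0,1) with B(x,r) ⊆ Ω. Then for every ε > 0 there is a constant C > 0, depending only on d, r, ε, the coefficients of H, the potential V and the point x, such that for every λ ∈ ℂ with Re λ ≥ 1 and every smooth solution ψ_λ of (H + V)ψ_λ = λψ_λ on Ω one has |ψ_λ(x)| ≤ C (Re λ)^{(d−1)/(2m) + ε} ‖ψ_λ‖_{L²(B(x,r))}. -/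
open MeasureTheory Metric Complex Finset ENNReal NNReal

noncomputable section

variable {d : ℕ}

/-- Euclidean space ℝ^d. -/
abbrev Euc (d : ℕ) := EuclideanSpace ℝ (Fin d)

/-- Partial derivative in coordinate direction `j`. -/
def pd (j : Fin d) (f : Euc d → ℂ) : Euc d → ℂ :=
  fun x => fderiv ℝ f x (EuclideanSpace.single j 1)

/-- The operator `D^γ = (−i∂₁)^{γ₁} ⋯ (−i∂_d)^{γ_d}`. -/
def Dpow (γ : Fin d → ℕ) (f : Euc d → ℂ) : Euc d → ℂ :=
  fun x => (-Complex.I) ^ (∑ j, γ j) *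
    ((List.finRange d).foldr (fun j g => (pd j)^[γ j] g) f) x

/-- The `L²` norm of `f` on the set `s` (valued in `ℝ≥0∞`). -/
def L2 (f : Euc d → ℂ) (s : Set (Euc d)) : ℝ≥0∞ := eLpNorm f 2 (volume.restrict s)

/-- Euclidean norm of an integer vector `ξ ∈ ℤ^d`. -/
def znorm (ξ : Fin d → ℤ) : ℝ := Real.sqrt (∑ j, ((ξ j : ℝ)) ^ 2)

/-- Embedding of `ℤ^d` into `ℝ^d`. -/
def zcoe (ξ : Fin d → ℤ) : Euc d := (WithLp.equiv 2 (Fin d → ℝ)).symm (fun j => (ξ j : ℝ))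

/-- The symbol `P(ξ)` of a constant coefficient operator, evaluated at real `ξ`. -/
def symbR (P : MvPolynomial (Fin d) ℂ) (ξ : Euc d) : ℂ :=
  MvPolynomial.eval (fun j => (ξ j : ℂ)) P

/-- The symbol `P(ξ)` evaluated at an integer lattice point. -/
def symbZ (P : MvPolynomial (Fin d) ℂ) (ξ : Fin d → ℤ) : ℂ :=
  MvPolynomial.eval (fun j => ((ξ j : ℤ) : ℂ)) P

/-- The constant coefficient differential operator `H = Σ_{α} c_α D^α` with symbol `P`. -/
def toOp (P : MvPolynomial (Fin d) ℂ) (f : Euc d → ℂ) : Euc d → ℂ :=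
  fun x => ∑ α ∈ P.support, P.coeff α * Dpow (fun j => α j) f x

/-- The axis-parallel cube of side length `2π` centered at `x₀`. -/
def cube (x₀ : Euc d) : Set (Euc d) :=
  {y | ∀ j, y j ∈ Set.Icc (x₀ j - Real.pi) (x₀ j + Real.pi)}

/-- The smooth cutoff of `ψ`: `x ↦ χ((x−x₀)/r) ψ(x)`. -/
def cutoffFn (χ : Euc d → ℝ) (x₀ : Euc d) (r : ℝ) (ψ : Euc d → ℂ) : Euc d → ℂ :=
  fun x => (χ (r⁻¹ • (x - x₀)) : ℂ) * ψ x

/-- The `2πℤ^d`-periodization of a function `F : ℝ^d → ℂ`. -/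
def perFn (F : Euc d → ℂ) : Euc d → ℂ :=
  fun x => ∑' k : Fin d → ℤ,
    F (x - (WithLp.equiv 2 (Fin d → ℝ)).symm (fun j => 2 * Real.pi * (k j : ℝ)))

/-- Fourier coefficient (w.r.t. the cube of side `2π` centered at `x₀`):
`Ĝ(ξ) = (2π)^{-d} ∫_{cube} G(x) e^{-i⟨ξ,x⟩} dx`. -/
def fCoeff (x₀ : Euc d) (G : Euc d → ℂ) (ξ : Fin d → ℤ) : ℂ :=
  ((2 * Real.pi) ^ d : ℝ)⁻¹ *
    ∫ x in cube x₀, G x * Complex.exp (-Complex.I * ((∑ j, (ξ j : ℝ) * x j : ℝ) : ℂ))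

/-- The Fourier coefficients `Ψ̂(ξ)` of the periodized cutoff `Ψ` of `ψ`. -/
def PsiHat (χ : Euc d → ℝ) (x₀ : Euc d) (r : ℝ) (ψ : Euc d → ℂ) (ξ : Fin d → ℤ) : ℂ :=
  fCoeff x₀ (perFn (cutoffFn χ x₀ r ψ)) ξ


open scoped FourierTransform ContDiff

/-- Smooth compactly supported functions. -/
def Nice (f : Euc d → ℂ) : Prop := ContDiff ℝ ∞ f ∧ HasCompactSupport f

/-- The Schwartz function attached to a test function. -/
def Nice.sch {f : Euc d → ℂ} (h : Nice f) : SchwartzMap (Euc d) ℂ := h.2.toSchwartzMap h.1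

lemma Nice.sch_coe {f : Euc d → ℂ} (h : Nice f) : (h.sch : Euc d → ℂ) = f := by
  ext x; rfl

lemma Nice.integrable {f : Euc d → ℂ} (h : Nice f) : Integrable f :=
  h.1.continuous.integrable_of_hasCompactSupport h.2

lemma Nice.pd {f : Euc d → ℂ} (h : Nice f) (j : Fin d) : Nice (pd j f) := by
  constructor
  · have : ContDiff ℝ ∞ (fderiv ℝ f) := h.1.fderiv_right (by simp)
    exact this.clm_apply contDiff_const
  · have := h.2.fderiv (𝕜 := ℝ)
    exact this.comp_left (g := fun L : Euc d →L[ℝ] ℂ => L (EuclideanSpace.single j 1)) (by simp)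

lemma Nice.add {f g : Euc d → ℂ} (h : Nice f) (h' : Nice g) : Nice (f + g) :=
  ⟨h.1.add h'.1, h.2.add h'.2⟩

lemma Nice.const_mul {f : Euc d → ℂ} (h : Nice f) (c : ℂ) : Nice (fun y => c * f y) :=
  ⟨contDiff_const.mul h.1, h.2.mul_left⟩

lemma Nice.sub {f g : Euc d → ℂ} (h : Nice f) (h' : Nice g) : Nice (f - g) := by
  have := h.add (h'.const_mul (-1))
  convert this using 1
  ext; simp [sub_eq_add_neg]

lemma Nice.mul {f g : Euc d → ℂ} (h : Nice f) (h' : Nice g) : Nice (f * g) :=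
  ⟨h.1.mul h'.1, h.2.mul_right⟩

lemma nice_zero : Nice (0 : Euc d → ℂ) := ⟨contDiff_const, HasCompactSupport.zero⟩

lemma Nice.sum {ι : Type*} (s : Finset ι) (f : ι → Euc d → ℂ) (h : ∀ i ∈ s, Nice (f i)) :
    Nice (fun y => ∑ i ∈ s, f i y) := by
  classical
  induction s using Finset.induction_on with
  | empty => simp only [Finset.sum_empty]; exact nice_zero
  | insert a s ha ih =>
    simp only [Finset.sum_insert ha]
    exact (h a (by simp)).add (ih fun i hi => h i (by simp [hi]))

lemma four_add {f g : Euc d → ℂ} (h : Nice f) (h' : Nice g) (ξ : Euc d) :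
    𝓕 (f + g) ξ = 𝓕 f ξ + 𝓕 g ξ := by
  rw [Real.fourier_eq, Real.fourier_eq, Real.fourier_eq, ← integral_add]
  · simp
  · exact (Real.fourierIntegral_convergent_iff ξ).2 h.integrable
  · exact (Real.fourierIntegral_convergent_iff ξ).2 h'.integrable

lemma four_const_mul (f : Euc d → ℂ) (c : ℂ) (ξ : Euc d) :
    𝓕 (fun y => c * f y) ξ = c * 𝓕 f ξ := by
  rw [Real.fourier_eq, Real.fourier_eq, ← integral_const_mul]
  congr 1; ext y
  simp only [Circle.smul_def, smul_eq_mul]; ring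

lemma four_sub {f g : Euc d → ℂ} (h : Nice f) (h' : Nice g) (ξ : Euc d) :
    𝓕 (f - g) ξ = 𝓕 f ξ - 𝓕 g ξ := by
  have := four_add h (h'.const_mul (-1)) ξ
  rw [four_const_mul] at this
  have e : f - g = f + fun y => -1 * g y := by ext; simp [sub_eq_add_neg]
  rw [e, this]; ring

lemma four_zero (ξ : Euc d) : 𝓕 (0 : Euc d → ℂ) ξ = 0 := by
  rw [Real.fourier_eq]; simp

lemma four_sum {ι : Type*} (s : Finset ι) (f : ι → Euc d → ℂ) (h : ∀ i ∈ s, Nice (f i))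
    (ξ : Euc d) : 𝓕 (fun y => ∑ i ∈ s, f i y) ξ = ∑ i ∈ s, 𝓕 (f i) ξ := by
  classical
  induction s using Finset.induction_on with
  | empty => simp only [Finset.sum_empty]; exact four_zero ξ
  | insert a s ha ih =>
    simp only [Finset.sum_insert ha]
    have := four_add (h a (by simp)) (Nice.sum s f fun i hi => h i (by simp [hi])) ξ
    rw [← ih fun i hi => h i (by simp [hi])]
    exact this

lemma four_pd {f : Euc d → ℂ} (h : Nice f) (j : Fin d) (ξ : Euc d) :
    𝓕 (pd j f) ξ = (2 * Real.pi * Complex.I * (ξ j : ℂ)) * 𝓕 f ξ := by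
  have h1 := SchwartzMap.fourier_lineDerivOp_eq h.sch (EuclideanSpace.single j 1)
  have h2 := congrArg (fun g : SchwartzMap (Euc d) ℂ => g ξ) h1
  simp only [SchwartzMap.fourier_coe] at h2
  have e : ((LineDeriv.lineDerivOp (EuclideanSpace.single j (1:ℝ)) h.sch : SchwartzMap (Euc d) ℂ) : Euc d → ℂ) = pd j f := by
    ext y
    rw [SchwartzMap.lineDerivOp_apply_eq_fderiv, h.sch_coe]; rfl
  rw [e] at h2
  rw [h2]
  rw [_root_.smul_apply, SchwartzMap.smulLeftCLM_apply_apply (by fun_prop)]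
  simp [SchwartzMap.fourier_coe, h.sch_coe, EuclideanSpace.inner_single_right]
  ring

lemma four_cont {f : Euc d → ℂ} (h : Nice f) : Continuous (𝓕 f) := by
  have := (𝓕 h.sch : SchwartzMap (Euc d) ℂ).continuous
  rwa [SchwartzMap.fourier_coe, h.sch_coe] at this

lemma four_integrable {f : Euc d → ℂ} (h : Nice f) : Integrable (𝓕 f) := by
  have := (𝓕 h.sch : SchwartzMap (Euc d) ℂ).integrable (μ := volume)
  rwa [SchwartzMap.fourier_coe, h.sch_coe] at this

lemma plancherel {f : Euc d → ℂ} (h : Nice f) :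
    ∫⁻ ξ, ‖𝓕 f ξ‖ₑ ^ 2 = ∫⁻ y, ‖f y‖ₑ ^ 2 := by
  have key : ∀ g : SchwartzMap (Euc d) ℂ, ∫⁻ y, ‖g y‖ₑ ^ 2 = ENNReal.ofReal (∫ y, ‖g y‖ ^ 2) := by
    intro g
    rw [ofReal_integral_eq_lintegral_ofReal]
    · congr 1; ext y
      rw [ENNReal.ofReal_pow (norm_nonneg _), ofReal_norm]
    · exact (memLp_two_iff_integrable_sq_norm g.continuous.aestronglyMeasurable).1 (g.memLp 2 _)
    · exact Filter.Eventually.of_forall fun _ => by positivity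
  have h1 := key h.sch
  have h2 := key (𝓕 h.sch)
  rw [SchwartzMap.integral_norm_sq_fourier, ← h1] at h2
  rwa [SchwartzMap.fourier_coe, h.sch_coe] at h2

lemma sup_bound {f : Euc d → ℂ} (h : Nice f) (x : Euc d) : ‖f x‖ₑ ≤ ∫⁻ ξ, ‖𝓕 f ξ‖ₑ := by
  have := h.1.continuous.fourierInv_fourier_eq h.integrable (four_integrable h)
  rw [← this, Real.fourierInv_eq]
  refine (enorm_integral_le_lintegral_enorm _).trans (le_of_eq ?_)
  rw [this]
  congr 1; ext y
  rw [← ofReal_norm, Circle.norm_smul, ofReal_norm]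

/-- Cutoffs supported in a ball. -/
def Cut (x : Euc d) (ρ : ℝ) (χ : Euc d → ℂ) : Prop := Nice χ ∧ tsupport χ ⊆ ball x ρ

lemma Cut.pd {x : Euc d} {ρ : ℝ} {χ : Euc d → ℂ} (h : Cut x ρ χ) (j : Fin d) :
    Cut x ρ (pd j χ) := by
  refine ⟨h.1.pd j, subset_trans ?_ h.2⟩
  refine subset_trans ?_ (tsupport_fderiv_subset ℝ (f := χ))
  apply closure_mono
  intro y hy
  simp only [Function.mem_support, _root_.pd] at hy ⊢
  intro h0; rw [h0] at hy; simp at hy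

lemma Cut.mul_left {x : Euc d} {ρ : ℝ} {χ W : Euc d → ℂ} (h : Cut x ρ χ) (hW : Nice W) :
    Cut x ρ (W * χ) :=
  ⟨hW.mul h.1, (tsupport_mul_subset_right).trans h.2⟩

lemma pd_mul {f g : Euc d → ℂ} (hf : Nice f) (hg : Nice g) (j : Fin d) :
    pd j (f * g) = pd j f * g + f * pd j g := by
  ext y
  have h1 : DifferentiableAt ℝ f y := (hf.1.differentiable (by simp)) y
  have h2 : DifferentiableAt ℝ g y := (hg.1.differentiable (by simp)) y
  simp only [pd, Pi.add_apply, Pi.mul_apply]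
  rw [fderiv_mul h1 h2]
  simp [mul_comm]; ring

lemma pd_sub {f g : Euc d → ℂ} (hf : Nice f) (hg : Nice g) (j : Fin d) :
    pd j (f - g) = pd j f - pd j g := by
  ext y
  have h1 : DifferentiableAt ℝ f y := (hf.1.differentiable (by simp)) y
  have h2 : DifferentiableAt ℝ g y := (hg.1.differentiable (by simp)) y
  simp only [pd, Pi.sub_apply]
  rw [fderiv_sub h1 h2]
  simp

/-- Iterated partial derivatives along a list of directions. -/
def Dl (l : List (Fin d)) (f : Euc d → ℂ) : Euc d → ℂ := l.foldr pd f

lemma Nice.Dl {f : Euc d → ℂ} (h : Nice f) (l : List (Fin d)) : Nice (Dl l f) := by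
  induction l with
  | nil => exact h
  | cons j l ih => exact ih.pd j

lemma four_Dl {f : Euc d → ℂ} (h : Nice f) (l : List (Fin d)) (ξ : Euc d) :
    𝓕 (Dl l f) ξ = (l.map fun j => (2 * Real.pi * Complex.I * (ξ j : ℂ))).prod * 𝓕 f ξ := by
  induction l with
  | nil => simp [Dl]
  | cons j l ih =>
    have := four_pd (h.Dl l) j ξ
    rw [ih] at this
    simp only [List.map_cons, List.prod_cons, mul_assoc] at this ⊢
    exact this

lemma norm_pd_symb (ξ : Euc d) (j : Fin d) :
    ‖(2 * Real.pi * Complex.I * (ξ j : ℂ))‖ ≤ 2 * Real.pi * (1 + ‖ξ‖) := by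
  have h1 : |ξ j| ≤ ‖ξ‖ := by simpa using PiLp.norm_apply_le ξ j
  have : ‖(2 * Real.pi * Complex.I * (ξ j : ℂ))‖ = 2 * Real.pi * |ξ j| := by
    simp [abs_of_pos Real.pi_pos]
  rw [this]
  have := Real.pi_pos
  gcongr; linarith

lemma norm_four_pd_le {f : Euc d → ℂ} (h : Nice f) (j : Fin d) (ξ : Euc d) :
    ‖𝓕 (pd j f) ξ‖ ≤ 2 * Real.pi * (1 + ‖ξ‖) * ‖𝓕 f ξ‖ := by
  rw [four_pd h, norm_mul]
  gcongr
  exact norm_pd_symb ξ j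

/-- The sum of the moduli of the Fourier transforms of the cut off functions. -/
def Sf (L : List (Euc d → ℂ)) (φ : Euc d → ℂ) (ξ : Euc d) : ℝ :=
  (L.map fun χ => ‖𝓕 (χ * φ) ξ‖).sum

lemma Sf_append (L L' : List (Euc d → ℂ)) (φ : Euc d → ℂ) (ξ : Euc d) :
    Sf (L ++ L') φ ξ = Sf L φ ξ + Sf L' φ ξ := by simp [Sf]

lemma Sf_nonneg (L : List (Euc d → ℂ)) (φ : Euc d → ℂ) (ξ : Euc d) : 0 ≤ Sf L φ ξ := by
  apply List.sum_nonneg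
  simp only [List.mem_map]
  rintro _ ⟨χ, -, rfl⟩
  positivity

/-- `T` is dominated, with polynomial growth of degree `n - 1`, by finitely many cutoffs. -/
def Dom (x : Euc d) (ρ : ℝ) (n : ℕ) (T : (Euc d → ℂ) → Euc d → ℂ) : Prop :=
  ∃ A : ℝ, 0 ≤ A ∧ ∃ L : List (Euc d → ℂ), (∀ χ ∈ L, Cut x ρ χ) ∧ ∀ φ, Nice φ → ∀ ξ,
    (1 + ‖ξ‖) * ‖𝓕 (T φ) ξ‖ ≤ A * (1 + ‖ξ‖) ^ n * Sf L φ ξ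

lemma Dom.add {x : Euc d} {ρ : ℝ} {n : ℕ} {T T' U : (Euc d → ℂ) → Euc d → ℂ}
    (h : Dom x ρ n T) (h' : Dom x ρ n T')
    (hU : ∀ φ, Nice φ → ∀ ξ, ‖𝓕 (U φ) ξ‖ ≤ ‖𝓕 (T φ) ξ‖ + ‖𝓕 (T' φ) ξ‖) : Dom x ρ n U := by
  obtain ⟨A, hA, L, hL, h⟩ := h
  obtain ⟨A', hA', L', hL', h'⟩ := h'
  refine ⟨A + A', by positivity, L ++ L', ?_, ?_⟩
  · intro χ hχ
    rcases List.mem_append.1 hχ with h | h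
    exacts [hL _ h, hL' _ h]
  · intro φ hφ ξ
    have h1 := h φ hφ ξ
    have h2 := h' φ hφ ξ
    have h3 := mul_le_mul_of_nonneg_left (hU φ hφ ξ) (by positivity : 0 ≤ 1 + ‖ξ‖)
    rw [Sf_append]
    have h4 := Sf_nonneg L φ ξ
    have h5 := Sf_nonneg L' φ ξ
    have h6 : 0 ≤ A * (1 + ‖ξ‖) ^ n * Sf L' φ ξ := by positivity
    have h7 : 0 ≤ A' * (1 + ‖ξ‖) ^ n * Sf L φ ξ := by positivity
    nlinarith

lemma Dom.scale {x : Euc d} {ρ : ℝ} {n n' : ℕ} {T U : (Euc d → ℂ) → Euc d → ℂ}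
    (h : Dom x ρ n T) (c : ℝ) (hc : 0 ≤ c) (k : ℕ) (hn : n + k ≤ n')
    (hU : ∀ φ, Nice φ → ∀ ξ, ‖𝓕 (U φ) ξ‖ ≤ c * (1 + ‖ξ‖) ^ k * ‖𝓕 (T φ) ξ‖) :
    Dom x ρ n' U := by
  obtain ⟨A, hA, L, hL, h⟩ := h
  refine ⟨c * A, by positivity, L, hL, ?_⟩
  intro φ hφ ξ
  have h1 := h φ hφ ξ
  have h4 := Sf_nonneg L φ ξ
  calc (1 + ‖ξ‖) * ‖𝓕 (U φ) ξ‖ ≤ (1 + ‖ξ‖) * (c * (1 + ‖ξ‖) ^ k * ‖𝓕 (T φ) ξ‖) := by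
        gcongr; exact hU φ hφ ξ
    _ = c * (1 + ‖ξ‖) ^ k * ((1 + ‖ξ‖) * ‖𝓕 (T φ) ξ‖) := by ring
    _ ≤ c * (1 + ‖ξ‖) ^ k * (A * (1 + ‖ξ‖) ^ n * Sf L φ ξ) := by gcongr
    _ = c * A * (1 + ‖ξ‖) ^ (n + k) * Sf L φ ξ := by rw [pow_add]; ring
    _ ≤ c * A * (1 + ‖ξ‖) ^ n' * Sf L φ ξ := by
        gcongr
        linarith [norm_nonneg ξ]

lemma Dom.zero {x : Euc d} {ρ : ℝ} {n : ℕ} {T : (Euc d → ℂ) → Euc d → ℂ}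
    (h : ∀ φ, Nice φ → T φ = 0) : Dom x ρ n T :=
  ⟨0, le_rfl, [], by simp, fun φ hφ ξ => by rw [h φ hφ, four_zero]; simp⟩

lemma Dom.base {x : Euc d} {ρ : ℝ} {χ : Euc d → ℂ} (h : Cut x ρ χ) :
    Dom x ρ 1 (fun φ => χ * φ) :=
  ⟨1, zero_le_one, [χ], by simpa using h, fun φ hφ ξ => by simp [Sf]⟩

lemma dom_Dl {x : Euc d} {ρ : ℝ} (l : List (Fin d)) (χ : Euc d → ℂ) (h : Cut x ρ χ) :
    Dom x ρ (l.length + 1) (fun φ => Dl l (χ * φ)) := by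
  induction l with
  | nil => simpa [Dl] using Dom.base h
  | cons j l ih =>
    refine ih.scale (2 * Real.pi) (by positivity) 1 (by simp) fun φ hφ ξ => ?_
    rw [pow_one]
    exact norm_four_pd_le ((h.1.mul hφ).Dl l) j ξ

lemma dom_comm {x : Euc d} {ρ : ℝ} (l : List (Fin d)) : ∀ (χ : Euc d → ℂ), Cut x ρ χ →
    Dom x ρ l.length (fun φ => Dl l (χ * φ) - χ * Dl l φ) := by
  induction l with
  | nil => intro χ h; exact Dom.zero fun φ hφ => by simp [Dl]
  | cons j l ih =>
    intro χ h
    have h1 : Dom x ρ (l.length + 1) (fun φ => pd j (Dl l (χ * φ) - χ * Dl l φ)) := by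
      refine (ih χ h).scale (2 * Real.pi) (by positivity) 1 (by simp) fun φ hφ ξ => ?_
      rw [pow_one]
      exact norm_four_pd_le (((h.1.mul hφ).Dl l).sub (h.1.mul (hφ.Dl l))) j ξ
    have h2 : Dom x ρ (l.length + 1) (fun φ => pd j χ * Dl l φ) := by
      refine (dom_Dl l _ (h.pd j)).add
        ((ih _ (h.pd j)).scale 1 zero_le_one 0 (Nat.le_succ _) (U := fun φ => Dl l (pd j χ * φ) - pd j χ * Dl l φ)
          (fun φ hφ ξ => by simp)) fun φ hφ ξ => ?_
      have a1 := ((h.pd j).1.mul hφ).Dl l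
      have a2 := (h.pd j).1.mul (hφ.Dl l)
      have : pd j χ * Dl l φ = Dl l (pd j χ * φ) - (Dl l (pd j χ * φ) - pd j χ * Dl l φ) := by
        ext; simp
      have h4 := four_sub a1 (a1.sub a2) ξ
      rw [← this] at h4
      rw [h4]
      exact norm_sub_le _ _
    refine h1.add h2 fun φ hφ ξ => ?_
    have a1 := ((h.1.mul hφ).Dl l)
    have a2 := (h.1.mul (hφ.Dl l))
    have e : Dl (j :: l) (χ * φ) - χ * Dl (j :: l) φ
        = pd j (Dl l (χ * φ) - χ * Dl l φ) + pd j χ * Dl l φ := by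
      rw [pd_sub a1 a2, pd_mul h.1 (hφ.Dl l)]
      simp only [Dl, List.foldr_cons]
      ring
    simp only [e]
    rw [four_add ((a1.sub a2).pd j) ((h.pd j).1.mul (hφ.Dl l))]
    exact norm_add_le _ _

/-- The list of directions encoding a multi-index. -/
def mlist (γ : Fin d → ℕ) : List (Fin d) :=
  (List.finRange d).flatMap fun j => List.replicate (γ j) j

lemma foldr_replicate_pd (n : ℕ) (j : Fin d) (f : Euc d → ℂ) :
    (List.replicate n j).foldr pd f = (pd j)^[n] f := by
  induction n with
  | zero => rfl
  | succ n ih => rw [List.replicate_succ, List.foldr_cons, ih, Function.iterate_succ_apply']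

lemma foldr_mlist (γ : Fin d → ℕ) (f : Euc d → ℂ) (l : List (Fin d)) :
    l.foldr (fun j g => (pd j)^[γ j] g) f
      = (l.flatMap fun j => List.replicate (γ j) j).foldr pd f := by
  induction l with
  | nil => rfl
  | cons j l ih =>
    rw [List.flatMap_cons, List.foldr_append, foldr_replicate_pd, List.foldr_cons, ih]

lemma Dpow_eq (γ : Fin d → ℕ) (f : Euc d → ℂ) :
    Dpow γ f = fun y => (-Complex.I) ^ (∑ j, γ j) * Dl (mlist γ) f y := by
  ext y
  simp only [Dpow, Dl, mlist, foldr_mlist]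

lemma length_mlist (γ : Fin d → ℕ) : (mlist γ).length = ∑ j, γ j := by
  simp [mlist, List.length_flatMap, ← List.sum_ofFn, List.ofFn_eq_map]

lemma four_Dpow {f : Euc d → ℂ} (h : Nice f) (γ : Fin d → ℕ) (ξ : Euc d) :
    𝓕 (Dpow γ f) ξ = (∏ j, ((2 * Real.pi * ξ j : ℝ) : ℂ) ^ γ j) * 𝓕 f ξ := by
  rw [Dpow_eq, four_const_mul, four_Dl h, ← mul_assoc]
  congr 1
  have : ∀ l : List (Fin d), ((l.flatMap fun j => List.replicate (γ j) j).map
      fun j => (2 * Real.pi * Complex.I * (ξ j : ℂ))).prod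
      = Complex.I ^ (l.map γ).sum * (l.map fun j => ((2 * Real.pi * ξ j : ℝ) : ℂ) ^ γ j).prod := by
    intro l
    induction l with
    | nil => simp
    | cons j l ih =>
      simp only [List.flatMap_cons, List.map_append, List.prod_append, ih, List.map_replicate,
        List.prod_replicate, List.map_cons, List.sum_cons, List.prod_cons, pow_add]
      push_cast
      ring
  rw [mlist, this, ← mul_assoc]
  have e1 : ((List.finRange d).map γ).sum = ∑ j, γ j := by
    rw [← List.ofFn_eq_map, List.sum_ofFn]
  have e2 : ((List.finRange d).map fun j => ((2 * Real.pi * ξ j : ℝ) : ℂ) ^ γ j).prod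
      = ∏ j, ((2 * Real.pi * ξ j : ℝ) : ℂ) ^ γ j := by
    rw [← List.ofFn_eq_map, List.prod_ofFn]
  rw [e1, e2, ← mul_pow]
  simp

lemma Nice.Dpow {f : Euc d → ℂ} (h : Nice f) (γ : Fin d → ℕ) : Nice (Dpow γ f) := by
  rw [Dpow_eq]; exact (h.Dl _).const_mul _

lemma Nice.toOp {f : Euc d → ℂ} (h : Nice f) (P : MvPolynomial (Fin d) ℂ) : Nice (toOp P f) :=
  Nice.sum _ _ fun α _ => (h.Dpow fun j => α j).const_mul _

lemma four_toOp {f : Euc d → ℂ} (h : Nice f) (P : MvPolynomial (Fin d) ℂ) (ξ : Euc d) :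
    𝓕 (toOp P f) ξ = symbR P ((2 * Real.pi) • ξ) * 𝓕 f ξ := by
  unfold toOp
  rw [four_sum _ _ fun α _ => (h.Dpow fun j => α j).const_mul _]
  simp only [four_const_mul]
  rw [symbR, MvPolynomial.eval_eq', Finset.sum_mul]
  refine Finset.sum_congr rfl fun α _ => ?_
  have := four_Dpow h (fun j => α j) ξ
  rw [this, ← mul_assoc]
  simp

lemma dom_Dpow {x : Euc d} {ρ : ℝ} (γ : Fin d → ℕ) (χ : Euc d → ℂ) (h : Cut x ρ χ) (c : ℂ)
    (m : ℕ) (hm : ∑ j, γ j ≤ m) :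
    Dom x ρ m (fun φ => fun y => c * (Dpow γ (χ * φ) y - χ y * Dpow γ φ y)) := by
  refine (dom_comm (mlist γ) χ h).scale ‖c‖ (norm_nonneg c) 0 (by rwa [length_mlist]) fun φ hφ ξ => ?_
  have : (fun y => c * (Dpow γ (χ * φ) y - χ y * Dpow γ φ y))
      = fun y => (c * (-Complex.I) ^ (∑ j, γ j)) * (Dl (mlist γ) (χ * φ) - χ * Dl (mlist γ) φ) y := by
    ext y
    simp only [Dpow_eq, Pi.sub_apply, Pi.mul_apply]; ring
  rw [this, four_const_mul]
  simp

lemma dom_finset {x : Euc d} {ρ : ℝ} {n : ℕ} {ι : Type*} (s : Finset ι)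
    (T : ι → (Euc d → ℂ) → Euc d → ℂ) (hT : ∀ i ∈ s, Dom x ρ n (T i))
    (hN : ∀ i ∈ s, ∀ φ, Nice φ → Nice (T i φ)) :
    Dom x ρ n (fun φ y => ∑ i ∈ s, T i φ y) := by
  classical
  induction s using Finset.induction_on with
  | empty => exact Dom.zero fun φ hφ => by ext; simp
  | insert a s ha ih =>
    simp only [Finset.sum_insert ha]
    refine (hT a (by simp)).add (ih (fun i hi => hT i (by simp [hi]))
      (fun i hi => hN i (by simp [hi]))) fun φ hφ ξ => ?_
    have := four_add (hN a (by simp) φ hφ)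
      (Nice.sum s (fun i => T i φ) fun i hi => hN i (by simp [hi]) φ hφ) ξ
    refine le_trans (le_of_eq ?_) (norm_add_le _ _)
    rw [← this]; rfl

lemma dom_toOp {x : Euc d} {ρ : ℝ} (P : MvPolynomial (Fin d) ℂ) (m : ℕ) (hm : P.totalDegree ≤ m)
    (χ : Euc d → ℂ) (h : Cut x ρ χ) :
    Dom x ρ m (fun φ => toOp P (χ * φ) - χ * toOp P φ) := by
  have := dom_finset (x := x) (ρ := ρ) (n := m) P.support
    (fun α φ y => P.coeff α * (Dpow (fun j => α j) (χ * φ) y - χ y * Dpow (fun j => α j) φ y))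
    (fun α hα => dom_Dpow _ χ h _ m (by
      refine le_trans ?_ ((MvPolynomial.le_totalDegree hα).trans hm)
      rw [Finsupp.sum_fintype _ _ (by simp)]))
    (fun α hα φ hφ => (((h.1.mul hφ).Dpow _).sub (h.1.mul (hφ.Dpow _))).const_mul _)
  convert this using 2 with φ
  ext y
  simp only [toOp, Pi.sub_apply, Pi.mul_apply, Finset.mul_sum, ← Finset.sum_sub_distrib]
  refine Finset.sum_congr rfl fun α _ => ?_
  ring

/-- The weight `1 + | |2πξ| - k |`. -/
def wt (k : ℝ) (ξ : Euc d) : ℝ := 1 + |2 * Real.pi * ‖ξ‖ - k|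

lemma wt_pos (k : ℝ) (ξ : Euc d) : 0 < wt k ξ := by unfold wt; positivity

lemma wt_cont (k : ℝ) : Continuous (wt k : Euc d → ℝ) := by unfold wt; fun_prop

lemma symb_bound (m : ℕ) (P : MvPolynomial (Fin d) ℂ) (C₀ : ℝ) (hC₀ : 0 < C₀)
    (hsym : ∀ ξ : Euc d, 1 ≤ ‖ξ‖ → ‖symbR P ξ - ((‖ξ‖ ^ m : ℝ) : ℂ)‖ ≤ C₀ * ‖ξ‖ ^ (m - 1)) :
    ∃ C₁ : ℝ, 0 < C₁ ∧ ∀ (η : Euc d) (k : ℝ), 1 ≤ k →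
      ‖symbR P η - ((‖η‖ ^ m : ℝ) : ℂ)‖ ≤ C₁ * (max ‖η‖ k) ^ (m - 1) := by
  have hc : Continuous fun η : Euc d => symbR P η - ((‖η‖ ^ m : ℝ) : ℂ) := by
    have : Continuous fun η : Euc d => symbR P η := by
      unfold symbR
      simp only [MvPolynomial.eval_eq']
      fun_prop
    fun_prop
  obtain ⟨K, hK⟩ := (isCompact_closedBall (0 : Euc d) 1).exists_bound_of_continuousOn hc.continuousOn
  refine ⟨max C₀ K, lt_max_of_lt_left hC₀, fun η k hk => ?_⟩
  have hM : 1 ≤ max ‖η‖ k := le_max_of_le_right hk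
  rcases le_total 1 ‖η‖ with h | h
  · refine (hsym η h).trans ?_
    gcongr
    · exact le_max_left _ _
    · exact le_max_left _ _
  · refine (hK η (by simpa using h)).trans ((le_max_right C₀ K).trans ?_)
    exact le_mul_of_one_le_right (le_max_of_le_left hC₀.le) (one_le_pow₀ hM)

lemma pow_diff (n : ℕ) (a k : ℝ) (ha : 0 ≤ a) (hk : 0 ≤ k) :
    |a - k| * (max a k) ^ n ≤ |a ^ (n + 1) - k ^ (n + 1)| := by
  have key : ∀ a k : ℝ, 0 ≤ k → k ≤ a → (a - k) * a ^ n ≤ a ^ (n + 1) - k ^ (n + 1) := by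
    intro a k hk h
    have h1 : k ^ n ≤ a ^ n := by gcongr
    have := mul_le_mul_of_nonneg_left h1 hk
    rw [pow_succ, pow_succ]; linarith
  rcases le_total k a with h | h
  · rw [max_eq_left h, abs_of_nonneg (sub_nonneg.2 h)]
    exact (key a k hk h).trans (le_abs_self _)
  · rw [max_eq_right h, abs_sub_comm, abs_of_nonneg (sub_nonneg.2 h), abs_sub_comm]
    exact (key k a ha h).trans (le_abs_self _)

lemma lower_bound (n : ℕ) (P : MvPolynomial (Fin d) ℂ) (C₁ : ℝ) (η : Euc d) (k : ℝ) (hk : 1 ≤ k)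
    (h : ‖symbR P η - ((‖η‖ ^ (n + 1) : ℝ) : ℂ)‖ ≤ C₁ * (max ‖η‖ k) ^ n)
    (lam : ℂ) (hl : lam.re = k ^ (n + 1)) :
    (|‖η‖ - k| - C₁) * (max ‖η‖ k) ^ n ≤ ‖symbR P η - lam‖ := by
  have h1 := pow_diff n ‖η‖ k (norm_nonneg _) (by linarith)
  have h2 : |‖η‖ ^ (n + 1) - k ^ (n + 1)| ≤ ‖((‖η‖ ^ (n + 1) : ℝ) : ℂ) - lam‖ := by
    have := Complex.abs_re_le_norm (((‖η‖ ^ (n + 1) : ℝ) : ℂ) - lam)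
    rwa [Complex.sub_re, Complex.ofReal_re, hl] at this
  have h3 := norm_sub_le_norm_sub_add_norm_sub ((‖η‖ ^ (n + 1) : ℝ) : ℂ) (symbR P η) lam
  rw [norm_sub_rev _ (symbR P η)] at h3
  linarith

/-- Admissible data: the equation holds on the ball. -/
def Adm (x : Euc d) (ρ : ℝ) (P : MvPolynomial (Fin d) ℂ) (m : ℕ) (W : Euc d → ℂ)
    (lam : ℂ) (k : ℝ) (φ : Euc d → ℂ) : Prop :=
  1 ≤ k ∧ lam.re = k ^ m ∧ Nice φ ∧ ∀ y ∈ ball x ρ, toOp P φ y + W y * φ y = lam * φ y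

lemma step (m : ℕ) (hm : 2 ≤ m) (P : MvPolynomial (Fin d) ℂ) (hdeg : P.totalDegree ≤ m)
    (C₀ : ℝ) (hC₀ : 0 < C₀)
    (hsym : ∀ ξ : Euc d, 1 ≤ ‖ξ‖ → ‖symbR P ξ - ((‖ξ‖ ^ m : ℝ) : ℂ)‖ ≤ C₀ * ‖ξ‖ ^ (m - 1))
    (x : Euc d) (ρ : ℝ) (W : Euc d → ℂ) (hW : Nice W) (χ : Euc d → ℂ) (hχ : Cut x ρ χ) :
    ∃ A : ℝ, 0 ≤ A ∧ ∃ L : List (Euc d → ℂ), (∀ χ ∈ L, Cut x ρ χ) ∧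
      ∀ lam k φ, Adm x ρ P m W lam k φ → ∀ ξ, wt k ξ * ‖𝓕 (χ * φ) ξ‖ ≤ A * Sf L φ ξ := by
  obtain ⟨C₁, hC₁, hb⟩ := symb_bound m P C₀ hC₀ hsym
  have hU : Dom x ρ m (fun φ => (toOp P (χ * φ) - χ * toOp P φ) - (W * χ) * φ) := by
    refine (dom_toOp P m hdeg χ hχ).add
      ((Dom.base (hχ.mul_left hW)).scale 1 zero_le_one 0 (by omega) (n' := m)
        (U := fun φ => (W * χ) * φ) (fun φ hφ ξ => by simp)) fun φ hφ ξ => ?_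
    have a1 := ((hχ.1.mul hφ).toOp P).sub (hχ.1.mul (hφ.toOp P))
    have a2 := (hW.mul hχ.1).mul hφ
    rw [four_sub a1 a2]
    exact norm_sub_le _ _
  obtain ⟨A, hA, L, hL, h⟩ := hU
  obtain ⟨n, rfl⟩ : ∃ n, m = n + 1 := ⟨m - 1, by omega⟩
  refine ⟨2 * (C₁ + 1) + 2 * 2 ^ n * A, by positivity, χ :: L, ?_, ?_⟩
  · intro χ' h'
    rcases List.mem_cons.1 h' with rfl | h'
    exacts [hχ, hL _ h']
  rintro lam k φ ⟨hk, hl, hφ, heq⟩ ξ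
  have hF := h φ hφ ξ
  have hid : (toOp P (χ * φ) - χ * toOp P φ) - (W * χ) * φ
      = toOp P (χ * φ) - fun y => lam * (χ * φ) y := by
    ext y
    simp only [Pi.sub_apply, Pi.mul_apply]
    by_cases hy : y ∈ ball x ρ
    · have := heq y hy
      linear_combination -χ y * this
    · have : χ y = 0 := image_eq_zero_of_notMem_tsupport fun h => hy (hχ.2 h)
      rw [this]; ring
  have hFid : 𝓕 ((toOp P (χ * φ) - χ * toOp P φ) - (W * χ) * φ) ξ
      = (symbR P ((2 * Real.pi) • ξ) - lam) * 𝓕 (χ * φ) ξ := by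
    have a := hχ.1.mul hφ
    rw [hid, four_sub (a.toOp P) (a.const_mul lam), four_toOp a, four_const_mul]
    ring
  simp only [hFid] at hF
  have hS := Sf_nonneg L φ ξ
  have hcons : Sf (χ :: L) φ ξ = ‖𝓕 (χ * φ) ξ‖ + Sf L φ ξ := by simp [Sf]
  rw [hcons]
  set F := ‖𝓕 (χ * φ) ξ‖ with hFdef
  have hF0 : 0 ≤ F := norm_nonneg _
  set η := (2 * Real.pi) • ξ with hη
  have hnη : ‖η‖ = 2 * Real.pi * ‖ξ‖ := by
    rw [hη, norm_smul, Real.norm_of_nonneg (by positivity)]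
  have hlow := lower_bound n P C₁ η k hk (by simpa using hb η k hk) lam hl
  have hw : wt k ξ = 1 + |‖η‖ - k| := by rw [wt, hnη]
  set M := max ‖η‖ k with hM
  have hM1 : 1 ≤ M := le_max_of_le_right hk
  by_cases hc : wt k ξ ≤ 2 * (C₁ + 1)
  · calc wt k ξ * F ≤ 2 * (C₁ + 1) * F := by gcongr
      _ ≤ (2 * (C₁ + 1) + 2 * 2 ^ n * A) * (F + Sf L φ ξ) := by
        gcongr
        · have : 0 ≤ 2 * 2 ^ n * A := by positivity
          linarith
        · linarith
  · push Not at hc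
    have h1 : wt k ξ / 2 ≤ |‖η‖ - k| - C₁ := by linarith
    have h2 : wt k ξ / 2 * M ^ n ≤ ‖symbR P η - lam‖ :=
      (mul_le_mul_of_nonneg_right h1 (by positivity)).trans hlow
    have h3 : 1 + ‖ξ‖ ≤ 2 * M := by
      have h4 : ‖ξ‖ ≤ ‖η‖ := by
        rw [hnη]
        have := Real.pi_gt_three
        nlinarith [norm_nonneg ξ]
      have : ‖η‖ ≤ M := le_max_left _ _
      linarith
    have h5 : ‖symbR P η - lam‖ * F ≤ A * (1 + ‖ξ‖) ^ n * Sf L φ ξ := by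
      rw [norm_mul, pow_succ] at hF
      have hp : 0 < 1 + ‖ξ‖ := by positivity
      refine le_of_mul_le_mul_left ?_ hp
      calc _ ≤ _ := hF
        _ = _ := by ring
    have h6 : M ^ n * (wt k ξ * F) ≤ M ^ n * (2 * 2 ^ n * A * Sf L φ ξ) := by
      calc M ^ n * (wt k ξ * F) = 2 * ((wt k ξ / 2 * M ^ n) * F) := by ring
        _ ≤ 2 * (‖symbR P η - lam‖ * F) := by gcongr
        _ ≤ 2 * (A * (1 + ‖ξ‖) ^ n * Sf L φ ξ) := by gcongr
        _ ≤ 2 * (A * (2 * M) ^ n * Sf L φ ξ) := by gcongr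
        _ = _ := by rw [mul_pow]; ring
    have h7 := le_of_mul_le_mul_left h6 (by positivity)
    refine h7.trans ?_
    gcongr
    · linarith
    · linarith

/-- The weighted `L²` bound for one cutoff. -/
def Bdd (x : Euc d) (ρ : ℝ) (P : MvPolynomial (Fin d) ℂ) (m : ℕ) (W : Euc d → ℂ) (N : ℕ)
    (G : (Euc d → ℂ) → Euc d → ℝ) : Prop :=
  ∃ C : ℝ≥0, ∀ lam k φ, Adm x ρ P m W lam k φ →
    ∫⁻ ξ, ENNReal.ofReal (wt k ξ ^ N * G φ ξ) ^ 2 ≤ C * ∫⁻ y, ‖φ y‖ₑ ^ 2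

lemma Sf_cont {x : Euc d} {ρ : ℝ} (L : List (Euc d → ℂ)) (hL : ∀ χ ∈ L, Cut x ρ χ)
    {φ : Euc d → ℂ} (hφ : Nice φ) : Continuous (Sf L φ) := by
  induction L with
  | nil =>
    have : Sf ([] : List (Euc d → ℂ)) φ = fun _ => 0 := by ext; simp [Sf]
    rw [this]; exact continuous_const
  | cons χ L ih =>
    have h1 := ih fun χ' h => hL χ' (by simp [h])
    have h2 := (four_cont ((hL χ (by simp)).1.mul hφ)).norm
    have : Sf (χ :: L) φ = fun ξ => ‖𝓕 (χ * φ) ξ‖ + Sf L φ ξ := by ext; simp [Sf]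
    rw [this]
    exact h2.add h1

lemma ofReal_add_sq_le (a b : ℝ) (ha0 : 0 ≤ a) (hb0 : 0 ≤ b) :
    ENNReal.ofReal (a + b) ^ 2 ≤ 2 * ENNReal.ofReal a ^ 2 + 2 * ENNReal.ofReal b ^ 2 := by
  rw [← ENNReal.ofReal_pow (by positivity), ← ENNReal.ofReal_pow ha0, ← ENNReal.ofReal_pow hb0]
  have two : (2 : ℝ≥0∞) = ENNReal.ofReal 2 := by simp
  rw [two, ← ENNReal.ofReal_mul (by norm_num), ← ENNReal.ofReal_mul (by norm_num),
    ← ENNReal.ofReal_add (by positivity) (by positivity)]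
  apply ENNReal.ofReal_le_ofReal
  nlinarith [sq_nonneg (a - b)]

lemma bdd_list {x : Euc d} {ρ : ℝ} {P : MvPolynomial (Fin d) ℂ} {m : ℕ} {W : Euc d → ℂ} {N : ℕ}
    (L : List (Euc d → ℂ)) (hL : ∀ χ ∈ L, Cut x ρ χ)
    (h : ∀ χ ∈ L, Bdd x ρ P m W N (fun φ ξ => ‖𝓕 (χ * φ) ξ‖)) :
    Bdd x ρ P m W N (Sf L) := by
  induction L with
  | nil => exact ⟨0, fun lam k φ _ => by simp [Sf]⟩
  | cons χ L ih =>
    obtain ⟨C, hC⟩ := ih (fun χ' h' => hL χ' (by simp [h'])) (fun χ' h' => h χ' (by simp [h']))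
    obtain ⟨C', hC'⟩ := h χ (by simp)
    refine ⟨2 * C' + 2 * C, fun lam k φ ha => ?_⟩
    have h1 := hC lam k φ ha
    have h2 := hC' lam k φ ha
    have hm1 : Measurable fun ξ => ENNReal.ofReal (wt k ξ ^ N * ‖𝓕 (χ * φ) ξ‖) ^ 2 := by
      have := (((wt_cont (d := d) k).pow N).mul
        (four_cont ((hL χ (by simp)).1.mul ha.2.2.1)).norm).measurable
      exact this.ennreal_ofReal.pow_const 2
    calc ∫⁻ ξ, ENNReal.ofReal (wt k ξ ^ N * Sf (χ :: L) φ ξ) ^ 2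
        ≤ ∫⁻ ξ, (2 * ENNReal.ofReal (wt k ξ ^ N * ‖𝓕 (χ * φ) ξ‖) ^ 2
          + 2 * ENNReal.ofReal (wt k ξ ^ N * Sf L φ ξ) ^ 2) := by
          refine lintegral_mono fun ξ => ?_
          have hw := (wt_pos k ξ).le
          have hS := Sf_nonneg L φ ξ
          have e : Sf (χ :: L) φ ξ = ‖𝓕 (χ * φ) ξ‖ + Sf L φ ξ := by simp [Sf]
          rw [e]
          set a := wt k ξ ^ N * ‖𝓕 (χ * φ) ξ‖
          set b := wt k ξ ^ N * Sf L φ ξ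
          have ha0 : 0 ≤ a := by positivity
          have hb0 : 0 ≤ b := by positivity
          rw [mul_add]
          exact ofReal_add_sq_le a b ha0 hb0
      _ = 2 * (∫⁻ ξ, ENNReal.ofReal (wt k ξ ^ N * ‖𝓕 (χ * φ) ξ‖) ^ 2)
          + 2 * ∫⁻ ξ, ENNReal.ofReal (wt k ξ ^ N * Sf L φ ξ) ^ 2 := by
          rw [lintegral_add_left (hm1.const_mul 2), lintegral_const_mul' _ _ (by simp),
            lintegral_const_mul' _ _ (by simp)]
      _ ≤ 2 * (C' * ∫⁻ y, ‖φ y‖ₑ ^ 2) + 2 * (C * ∫⁻ y, ‖φ y‖ₑ ^ 2) := by gcongr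
      _ = _ := by push_cast; ring

lemma energy (m : ℕ) (hm : 2 ≤ m) (P : MvPolynomial (Fin d) ℂ) (hdeg : P.totalDegree ≤ m)
    (C₀ : ℝ) (hC₀ : 0 < C₀)
    (hsym : ∀ ξ : Euc d, 1 ≤ ‖ξ‖ → ‖symbR P ξ - ((‖ξ‖ ^ m : ℝ) : ℂ)‖ ≤ C₀ * ‖ξ‖ ^ (m - 1))
    (x : Euc d) (ρ : ℝ) (W : Euc d → ℂ) (hW : Nice W) (N : ℕ) :
    ∀ χ : Euc d → ℂ, Cut x ρ χ → Bdd x ρ P m W N (fun φ ξ => ‖𝓕 (χ * φ) ξ‖) := by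
  induction N with
  | zero =>
    intro χ hχ
    obtain ⟨K, hK⟩ := hχ.1.1.continuous.bounded_above_of_compact_support hχ.1.2
    refine ⟨K.toNNReal ^ 2, fun lam k φ ha => ?_⟩
    simp only [pow_zero, one_mul, ofReal_norm]
    rw [plancherel (hχ.1.mul ha.2.2.1), ← lintegral_const_mul' _ _ (by simp)]
    refine lintegral_mono fun y => ?_
    simp only [Pi.mul_apply, enorm_mul, mul_pow]
    push_cast
    gcongr
    rw [← ofReal_norm]
    exact ENNReal.ofReal_le_ofReal (hK y)
  | succ N ih =>
    intro χ hχ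
    obtain ⟨A, hA, L, hL, h⟩ := step m hm P hdeg C₀ hC₀ hsym x ρ W hW χ hχ
    obtain ⟨C, hC⟩ := bdd_list L hL fun χ' h' => ih χ' (hL χ' h')
    refine ⟨A.toNNReal ^ 2 * C, fun lam k φ ha => ?_⟩
    calc ∫⁻ ξ, ENNReal.ofReal (wt k ξ ^ (N + 1) * ‖𝓕 (χ * φ) ξ‖) ^ 2
        ≤ ∫⁻ ξ, ENNReal.ofReal A ^ 2 * ENNReal.ofReal (wt k ξ ^ N * Sf L φ ξ) ^ 2 := by
          refine lintegral_mono fun ξ => ?_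
          simp only
          rw [← mul_pow, ← ENNReal.ofReal_mul hA]
          refine pow_le_pow_left' (ENNReal.ofReal_le_ofReal ?_) 2
          have := mul_le_mul_of_nonneg_left (h lam k φ ha ξ) (pow_nonneg (wt_pos k ξ).le N)
          rw [pow_succ]
          linarith
      _ = ENNReal.ofReal A ^ 2 * ∫⁻ ξ, ENNReal.ofReal (wt k ξ ^ N * Sf L φ ξ) ^ 2 := by
          rw [lintegral_const_mul' _ _ (by simp)]
      _ ≤ ENNReal.ofReal A ^ 2 * (C * ∫⁻ y, ‖φ y‖ₑ ^ 2) := by gcongr; exact hC lam k φ ha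
      _ = _ := by push_cast; rw [mul_assoc]; rfl

lemma kernel_aux (n : ℕ) (k : ℝ) (hk : 1 ≤ k) (s : ℝ) (hs : 0 < s) :
    s ^ n * ((1 + |2 * Real.pi * s - k|) ^ (n + 2))⁻¹
      ≤ k ^ n * (1 + (2 * Real.pi * s - k) ^ 2)⁻¹ := by
  set t := |2 * Real.pi * s - k| with ht
  have ht0 : 0 ≤ t := abs_nonneg _
  have hsq : (2 * Real.pi * s - k) ^ 2 = t ^ 2 := by rw [ht, sq_abs]
  rw [hsq]
  have h1 : s ≤ k * (1 + t) := by
    have h2 : 2 * Real.pi * s - k ≤ t := le_abs_self _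
    have := Real.pi_gt_three
    nlinarith
  have h3 : s ^ n ≤ k ^ n * (1 + t) ^ n := by
    rw [← mul_pow]; gcongr
  calc s ^ n * ((1 + t) ^ (n + 2))⁻¹ ≤ k ^ n * (1 + t) ^ n * ((1 + t) ^ (n + 2))⁻¹ := by gcongr
    _ = k ^ n * ((1 + t) ^ 2)⁻¹ := by
      rw [pow_add]; field_simp
    _ ≤ k ^ n * (1 + t ^ 2)⁻¹ := by
      gcongr; nlinarith

lemma kernel_succ (n : ℕ) : ∃ B : ℝ, 0 ≤ B ∧ ∀ k : ℝ, 1 ≤ k →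
    ∫⁻ ξ : Euc (n + 1), ENNReal.ofReal ((wt k ξ ^ (n + 2))⁻¹) ≤ ENNReal.ofReal (B * k ^ n) := by
  set v := volume.real (ball (0 : Euc (n + 1)) 1) with hv
  set Z := ∫ s : ℝ, (1 + s ^ 2)⁻¹ with hZ
  have hZ0 : 0 ≤ Z := integral_nonneg fun s => by positivity
  refine ⟨(n + 1) * (v * (|(2 * Real.pi)⁻¹| * Z)), by positivity, fun k hk => ?_⟩
  set g : ℝ → ℝ := fun s => ((1 + |2 * Real.pi * s - k|) ^ (n + 2))⁻¹ with hg
  have hgc : Continuous g := by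
    apply Continuous.inv₀
    · fun_prop
    · intro s; positivity
  have hdim : Module.finrank ℝ (Euc (n + 1)) - 1 = n := by simp
  have hh : Integrable fun s : ℝ => k ^ n * (1 + (2 * Real.pi * s - k) ^ 2)⁻¹ := by
    refine Integrable.const_mul ?_ _
    have h1 := integrable_inv_one_add_sq.comp_sub_right k
    exact h1.comp_mul_left' (by positivity : (2 * Real.pi) ≠ 0)
  have hI : IntegrableOn (fun s : ℝ => s ^ n * g s) (Set.Ioi 0) := by
    refine Integrable.mono' hh.integrableOn (by fun_prop) ?_
    filter_upwards [ae_restrict_mem measurableSet_Ioi] with s hs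
    have hs : 0 < s := hs
    rw [Real.norm_of_nonneg (by simp only [hg]; positivity)]
    exact kernel_aux n k hk s hs
  have hInt : Integrable (fun ξ : Euc (n + 1) => g ‖ξ‖) := by
    rw [integrable_fun_norm_addHaar, hdim]
    exact hI
  have heq : ∫⁻ ξ : Euc (n + 1), ENNReal.ofReal ((wt k ξ ^ (n + 2))⁻¹)
      = ENNReal.ofReal (∫ ξ : Euc (n + 1), g ‖ξ‖) := by
    rw [ofReal_integral_eq_lintegral_ofReal hInt]
    · rfl
    · exact Filter.Eventually.of_forall fun ξ => by simp only [hg, Pi.zero_apply]; positivity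
  rw [heq]
  apply ENNReal.ofReal_le_ofReal
  rw [integral_fun_norm_addHaar volume g, hdim]
  simp only [smul_eq_mul, nsmul_eq_mul, finrank_euclideanSpace, Fintype.card_fin]
  have hle : ∫ s in Set.Ioi (0 : ℝ), s ^ n * g s ≤ k ^ n * (|(2 * Real.pi)⁻¹| * Z) := by
    calc ∫ s in Set.Ioi (0 : ℝ), s ^ n * g s
        ≤ ∫ s in Set.Ioi (0 : ℝ), k ^ n * (1 + (2 * Real.pi * s - k) ^ 2)⁻¹ := by
          refine setIntegral_mono_on hI hh.integrableOn measurableSet_Ioi fun s hs => ?_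
          exact kernel_aux n k hk s hs
      _ ≤ ∫ s : ℝ, k ^ n * (1 + (2 * Real.pi * s - k) ^ 2)⁻¹ :=
          setIntegral_le_integral hh (Filter.Eventually.of_forall fun s => by
            simp only [Pi.zero_apply]; positivity)
      _ = k ^ n * (|(2 * Real.pi)⁻¹| * Z) := by
          rw [integral_const_mul]
          congr 1
          have h1 := Measure.integral_comp_mul_left (fun u : ℝ => (1 + (u - k) ^ 2)⁻¹) (2 * Real.pi)
          rw [h1, smul_eq_mul, integral_sub_right_eq_self (fun u : ℝ => (1 + u ^ 2)⁻¹) k]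
  push_cast
  calc ((n : ℝ) + 1) * (v * ∫ s in Set.Ioi (0 : ℝ), s ^ n * g s)
      ≤ ((n : ℝ) + 1) * (v * (k ^ n * (|(2 * Real.pi)⁻¹| * Z))) := by gcongr
    _ = _ := by ring

lemma kernel_bound (d : ℕ) : ∃ B : ℝ, 0 ≤ B ∧ ∀ k : ℝ, 1 ≤ k →
    ∫⁻ ξ : Euc d, ENNReal.ofReal ((wt k ξ ^ (d + 1))⁻¹) ^ 2
      ≤ ENNReal.ofReal (B * k ^ ((d : ℝ) - 1)) := by
  have hsq : ∀ (k : ℝ) (ξ : Euc d), ENNReal.ofReal ((wt k ξ ^ (d + 1))⁻¹) ^ 2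
      ≤ ENNReal.ofReal ((wt k ξ ^ (d + 1))⁻¹) := by
    intro k ξ
    have h1 : 1 ≤ wt k ξ := by unfold wt; linarith [abs_nonneg (2 * Real.pi * ‖ξ‖ - k)]
    have h2 : ENNReal.ofReal ((wt k ξ ^ (d + 1))⁻¹) ≤ 1 := by
      rw [ENNReal.ofReal_le_one]
      exact inv_le_one_of_one_le₀ (one_le_pow₀ h1)
    rw [sq]
    exact mul_le_of_le_one_left' h2
  rcases d with _ | n
  · refine ⟨(volume (Set.univ : Set (Euc 0))).toReal, by positivity, fun k hk => ?_⟩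
    have hfin : volume (Set.univ : Set (Euc 0)) ≠ ⊤ := (isCompact_univ.measure_lt_top).ne
    calc ∫⁻ ξ : Euc 0, ENNReal.ofReal ((wt k ξ ^ (0 + 1))⁻¹) ^ 2
        ≤ ∫⁻ ξ : Euc 0, ENNReal.ofReal (k⁻¹) := by
          refine lintegral_mono fun ξ => (hsq k ξ).trans (ENNReal.ofReal_le_ofReal ?_)
          have hξ : ξ = 0 := Subsingleton.elim _ _
          have : wt k ξ = 1 + k := by
            rw [wt, hξ, norm_zero, mul_zero, zero_sub, abs_neg, abs_of_nonneg (by linarith)]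
          rw [this, zero_add, pow_one]
          gcongr
          linarith
      _ = ENNReal.ofReal (k⁻¹) * volume (Set.univ : Set (Euc 0)) := by rw [lintegral_const]
      _ = ENNReal.ofReal ((volume (Set.univ : Set (Euc 0))).toReal * k ^ (((0 : ℕ) : ℝ) - 1)) := by
          rw [ENNReal.ofReal_mul (by positivity), ENNReal.ofReal_toReal hfin, mul_comm]
          congr 2
          rw [Nat.cast_zero, zero_sub, Real.rpow_neg_one]
      _ ≤ _ := le_rfl
  · obtain ⟨B, hB, h⟩ := kernel_succ n
    refine ⟨B, hB, fun k hk => ?_⟩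
    have e : k ^ (((n + 1 : ℕ) : ℝ) - 1) = k ^ n := by
      rw [← Real.rpow_natCast]; congr 1; push_cast; ring
    rw [e]
    exact (lintegral_mono fun ξ => hsq k ξ).trans (h k hk)

lemma pointwise (m : ℕ) (hm : 2 ≤ m) (P : MvPolynomial (Fin d) ℂ) (hdeg : P.totalDegree ≤ m)
    (C₀ : ℝ) (hC₀ : 0 < C₀)
    (hsym : ∀ ξ : Euc d, 1 ≤ ‖ξ‖ → ‖symbR P ξ - ((‖ξ‖ ^ m : ℝ) : ℂ)‖ ≤ C₀ * ‖ξ‖ ^ (m - 1))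
    (x : Euc d) (ρ : ℝ) (W : Euc d → ℂ) (hW : Nice W) (χ : Euc d → ℂ) (hχ : Cut x ρ χ)
    (hχ1 : χ x = 1) :
    ∃ C : ℝ, 0 < C ∧ ∀ lam k φ, Adm x ρ P m W lam k φ →
      ‖φ x‖ₑ ≤ ENNReal.ofReal (C * k ^ (((d : ℝ) - 1) / 2))
        * (∫⁻ y, ‖φ y‖ₑ ^ 2) ^ (1 / 2 : ℝ) := by
  obtain ⟨E, hE⟩ := energy m hm P hdeg C₀ hC₀ hsym x ρ W hW (d + 1) χ hχ
  obtain ⟨B, hB, hk⟩ := kernel_bound d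
  refine ⟨(E : ℝ) ^ (1 / 2 : ℝ) * B ^ (1 / 2 : ℝ) + 1, by positivity, fun lam k φ ha => ?_⟩
  have hk1 := ha.1
  have hk0 : 0 ≤ k := by linarith
  have hn := hχ.1.mul ha.2.2.1
  have h1 := hE lam k φ ha
  have h2 := hk k hk1
  have h3 := sup_bound hn x
  simp only [Pi.mul_apply, hχ1, one_mul] at h3
  set f : Euc d → ℝ≥0∞ := fun ξ => ENNReal.ofReal (wt k ξ ^ (d + 1) * ‖𝓕 (χ * φ) ξ‖) with hf
  set g : Euc d → ℝ≥0∞ := fun ξ => ENNReal.ofReal ((wt k ξ ^ (d + 1))⁻¹) with hg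
  have hfm : Measurable f :=
    (((wt_cont (d := d) k).pow (d + 1)).mul (four_cont hn).norm).measurable.ennreal_ofReal
  have hgm : Measurable g :=
    ((wt_cont (d := d) k).pow (d + 1)).measurable.inv.ennreal_ofReal
  have hfg : ∀ ξ, ‖𝓕 (χ * φ) ξ‖ₑ = (f * g) ξ := by
    intro ξ
    have hw := wt_pos k ξ
    simp only [hf, hg, Pi.mul_apply]
    rw [← ENNReal.ofReal_mul (by positivity), ← ofReal_norm]
    congr 1
    field_simp
  have hol := ENNReal.lintegral_mul_le_Lp_mul_Lq volume Real.HolderConjugate.two_two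
    hfm.aemeasurable hgm.aemeasurable
  simp only [ENNReal.rpow_two] at hol
  simp only [hfg] at h3
  have half : (0 : ℝ) ≤ 1 / 2 := by norm_num
  calc ‖φ x‖ₑ ≤ _ := h3
    _ ≤ _ := hol
    _ ≤ (E * ∫⁻ y, ‖φ y‖ₑ ^ 2) ^ (1 / 2 : ℝ)
        * (ENNReal.ofReal (B * k ^ ((d : ℝ) - 1))) ^ (1 / 2 : ℝ) := by
        gcongr
    _ = ENNReal.ofReal ((E : ℝ) ^ (1 / 2 : ℝ) * B ^ (1 / 2 : ℝ) * k ^ (((d : ℝ) - 1) / 2))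
        * (∫⁻ y, ‖φ y‖ₑ ^ 2) ^ (1 / 2 : ℝ) := by
        rw [ENNReal.mul_rpow_of_nonneg _ _ half, ENNReal.ofReal_rpow_of_nonneg (by positivity) half,
          Real.mul_rpow hB (by positivity), ← Real.rpow_mul hk0, mul_one_div,
          mul_assoc ((E : ℝ) ^ (1 / 2 : ℝ)),
          ENNReal.ofReal_mul (p := (E : ℝ) ^ (1 / 2 : ℝ)) (by positivity),
          ← ENNReal.ofReal_rpow_of_nonneg E.coe_nonneg half, ENNReal.ofReal_coe_nnreal]
        ring
    _ ≤ _ := by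
        gcongr
        linarith

lemma pd_congr {f g : Euc d → ℂ} {y : Euc d} (h : f =ᶠ[nhds y] g) (j : Fin d) :
    pd j f =ᶠ[nhds y] pd j g := by
  filter_upwards [h.fderiv (𝕜 := ℝ)] with z hz
  simp only [pd, hz]

lemma Dl_congr {f g : Euc d → ℂ} {y : Euc d} (h : f =ᶠ[nhds y] g) (l : List (Fin d)) :
    Dl l f =ᶠ[nhds y] Dl l g := by
  induction l with
  | nil => exact h
  | cons j l ih => exact pd_congr ih j

lemma toOp_congr {f g : Euc d → ℂ} {y : Euc d} (h : f =ᶠ[nhds y] g) (P : MvPolynomial (Fin d) ℂ) :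
    toOp P f y = toOp P g y := by
  unfold toOp
  refine Finset.sum_congr rfl fun α _ => ?_
  rw [Dpow_eq, Dpow_eq]
  simp only [(Dl_congr h (mlist fun j => α j)).eq_of_nhds]

/-- The complex-valued version of a bump function. -/
def cb {x : Euc d} (b : ContDiffBump x) : Euc d → ℂ := fun y => ((b y : ℝ) : ℂ)

lemma cb_tsupport {x : Euc d} (b : ContDiffBump x) : tsupport (cb b) ⊆ closedBall x b.rOut := by
  rw [← b.tsupport_eq]
  apply closure_mono
  intro y hy
  simp only [Function.mem_support, cb] at hy ⊢
  intro h; rw [h] at hy; simp at hy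

lemma cb_contDiff {x : Euc d} (b : ContDiffBump x) : ContDiff ℝ ∞ (cb b) :=
  Complex.ofRealCLM.contDiff.comp b.contDiff

lemma cb_nice {x : Euc d} (b : ContDiffBump x) : Nice (cb b) :=
  ⟨cb_contDiff b, HasCompactSupport.intro (isCompact_closedBall x b.rOut) fun y hy =>
    image_eq_zero_of_notMem_tsupport fun h => hy (cb_tsupport b h)⟩

lemma cb_mul_nice {x : Euc d} (b : ContDiffBump x) {Ω : Set (Euc d)} (hΩ : IsOpen Ω)
    (hb : closedBall x b.rOut ⊆ Ω) {f : Euc d → ℂ} (hf : ContDiffOn ℝ ∞ f Ω) :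
    Nice (cb b * f) := by
  refine ⟨?_, (cb_nice b).2.mul_right⟩
  rw [contDiff_iff_contDiffAt]
  intro y
  by_cases hy : y ∈ Ω
  · exact (cb_contDiff b).contDiffAt.mul (hf.contDiffAt (hΩ.mem_nhds hy))
  · have h1 : y ∉ tsupport (cb b) := fun h => hy (hb (cb_tsupport b h))
    have h2 : cb b =ᶠ[nhds y] 0 := notMem_tsupport_iff_eventuallyEq.1 h1
    have h3 : cb b * f =ᶠ[nhds y] fun _ => 0 := by
      filter_upwards [h2] with z hz
      simp [hz]
    exact contDiffAt_const.congr_of_eventuallyEq h3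

/-- for an `m`-th order constant coefficient operator `H` (`m ≥ 2`)
whose symbol satisfies `|P(ξ) − |ξ|^m| ≤ C₀|ξ|^{m−1}` for `|ξ| ≥ 1`, every smooth solution
of `(H+V)ψ_λ = λψ_λ` with `Re λ ≥ 1` satisfies
`|ψ_λ(x)| ≤ C (Re λ)^{(d−1)/(2m)+ε} ‖ψ_λ‖_{L²(B(x,r))}`, with `C` independent of `λ, ψ_λ`. -/
theorem statement11
    (d m : ℕ) (hm : 2 ≤ m) (Ω : Set (Euc d)) (hΩ : IsOpen Ω) (hne : Ω.Nonempty)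
    (P : MvPolynomial (Fin d) ℂ) (hdeg : P.totalDegree ≤ m)
    (C₀ : ℝ) (hC₀ : 0 < C₀)
    (hsym : ∀ ξ : Euc d, 1 ≤ ‖ξ‖ → ‖symbR P ξ - ((‖ξ‖ ^ m : ℝ) : ℂ)‖ ≤ C₀ * ‖ξ‖ ^ (m - 1))
    (V : Euc d → ℂ) (hV : ContDiffOn ℝ (⊤ : ℕ∞) V Ω)
    (x : Euc d) (hx : x ∈ Ω) (r : ℝ) (hr : r ∈ Set.Ioo (0 : ℝ) 1)
    (hball : ball x r ⊆ Ω) (ε : ℝ) (hε : 0 < ε) :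
    ∃ C : ℝ, 0 < C ∧ ∀ (lam : ℂ), 1 ≤ lam.re → ∀ ψ : Euc d → ℂ,
      ContDiffOn ℝ (⊤ : ℕ∞) ψ Ω →
      (∀ y ∈ Ω, toOp P ψ y + V y * ψ y = lam * ψ y) →
      (‖ψ x‖₊ : ℝ≥0∞) ≤
        ENNReal.ofReal (C * lam.re ^ (((d : ℝ) - 1) / (2 * m) + ε)) *
          L2 ψ (ball x r) := by
  obtain ⟨hr0, hr1⟩ := hr
  let b : ContDiffBump x := ⟨r / 3, r / 2, by positivity, by linarith⟩
  let c : ContDiffBump x := ⟨r / 8, r / 4, by positivity, by linarith⟩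
  have hbΩ : closedBall x b.rOut ⊆ ball x r := closedBall_subset_ball (by change r / 2 < r; linarith)
  have hcut : Cut x (r / 3) (cb c) :=
    ⟨cb_nice c, (cb_tsupport c).trans (closedBall_subset_ball (by change r / 4 < r / 3; linarith))⟩
  have hc1 : cb c x = 1 := by
    simp only [cb]
    rw [c.one_of_mem_closedBall (mem_closedBall_self (by change 0 ≤ r / 8; positivity))]
    simp
  have hb1 : ∀ y ∈ ball x (r / 3), cb b y = 1 := by
    intro y hy
    simp only [cb]
    rw [b.one_of_mem_closedBall (ball_subset_closedBall hy)]
    simp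
  obtain ⟨C, hC, hmain⟩ := pointwise m hm P hdeg C₀ hC₀ hsym x (r / 3) (cb b * V)
    (cb_mul_nice b hΩ (hbΩ.trans hball) hV) (cb c) hcut hc1
  refine ⟨C, hC, fun lam hlam ψ hψ heq => ?_⟩
  have hm0 : (m : ℝ) ≠ 0 := by
    have : (2 : ℝ) ≤ m := by exact_mod_cast hm
    positivity
  have hl0 : 0 ≤ lam.re := by linarith
  have hadm : Adm x (r / 3) P m (cb b * V) lam (lam.re ^ ((m : ℝ)⁻¹)) (cb b * ψ) := by
    refine ⟨Real.one_le_rpow hlam (by positivity), ?_, cb_mul_nice b hΩ (hbΩ.trans hball) hψ, ?_⟩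
    · exact (Real.rpow_inv_natCast_pow hl0 (by omega)).symm
    · intro y hy
      have hev : cb b * ψ =ᶠ[nhds y] ψ := by
        filter_upwards [isOpen_ball.mem_nhds hy] with z hz
        simp [hb1 z hz]
      rw [toOp_congr hev P]
      simp only [Pi.mul_apply, hb1 y hy, one_mul]
      exact heq y (hball (ball_subset_ball (by linarith) hy))
  have h := hmain lam _ _ hadm
  have hxx : (cb b * ψ) x = ψ x := by
    rw [Pi.mul_apply, hb1 x (mem_ball_self (by positivity)), one_mul]
  rw [hxx] at h
  have hL2 : L2 ψ (ball x r) = (∫⁻ y in ball x r, ‖ψ y‖ₑ ^ 2) ^ (1 / 2 : ℝ) := by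
    rw [L2, eLpNorm_eq_lintegral_rpow_enorm_toReal (by simp) (by simp)]
    simp
  have hinteg : ∫⁻ y, ‖(cb b * ψ) y‖ₑ ^ 2 ≤ ∫⁻ y in ball x r, ‖ψ y‖ₑ ^ 2 := by
    rw [← lintegral_indicator measurableSet_ball]
    refine lintegral_mono fun y => ?_
    by_cases hy : y ∈ ball x r
    · rw [Set.indicator_of_mem hy, Pi.mul_apply, enorm_mul]
      refine pow_le_pow_left' (mul_le_of_le_one_left' ?_) 2
      rw [← ofReal_norm, ENNReal.ofReal_le_one]
      simp only [cb, Complex.norm_real, Real.norm_of_nonneg b.nonneg]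
      exact b.le_one
    · have : cb b y = 0 :=
        image_eq_zero_of_notMem_tsupport fun h => hy (hbΩ (cb_tsupport b h))
      simp [this]
  refine le_trans (le_of_eq ?_) (h.trans ?_)
  · rfl
  rw [hL2]
  gcongr
  rw [← Real.rpow_mul hl0]
  apply Real.rpow_le_rpow_of_exponent_le hlam
  have : (m : ℝ)⁻¹ * (((d : ℝ) - 1) / 2) = ((d : ℝ) - 1) / (2 * m) := by field_simp
  rw [this]; linarith

end
end

section
/- Let P(ξ) = Σ_{|α|≤m} c_α ξ^α be a polynomial of degree m ≥ 1 on ℝ^d with complex coefficients, with principal part σ(ξ) = Σ_{|α|=m} c_α ξ^α. Suppose P is not elliptic, i.e. there exists ζ ∈ ℝ^d \ {0} with σ(ζ) = 0. Then for every λ ∈ ℂ and every δ ∈ (0,1), the set {ξ ∈ ℤ^d : |P(ξ) − λ| ≤ |ξ|^{m−1+δ}} is infinite. -/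
open MeasureTheory Metric Complex Finset ENNReal NNReal

noncomputable section

variable {d : ℕ}

/-- The lattice point obtained by rounding `t ζ`. -/
def rnd (ζ : Fin d → ℝ) (t : ℕ) : Fin d → ℤ := fun j => round ((t : ℝ) * ζ j)

lemma rnd_scaled_isBigO (ζ : Fin d → ℝ) (j : Fin d) :
    (fun t : ℕ => ((rnd ζ t j : ℤ) : ℂ) / (t : ℂ) - (ζ j : ℂ))
      =O[Filter.atTop] (fun t : ℕ => ((t : ℝ))⁻¹) := by
  refine Asymptotics.IsBigO.of_bound 1 ?_
  filter_upwards [Filter.eventually_ge_atTop 1] with t ht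
  have ht0 : (0 : ℝ) < t := by exact_mod_cast ht
  have h : ((rnd ζ t j : ℤ) : ℂ) / (t : ℂ) - (ζ j : ℂ)
      = (((rnd ζ t j : ℝ) - t * ζ j) / t : ℝ) := by
    have : (t : ℂ) ≠ 0 := by exact_mod_cast ht0.ne'
    push_cast
    field_simp
  rw [h, Complex.norm_real, norm_div, norm_inv, one_mul, Real.norm_eq_abs, Real.norm_eq_abs,
    abs_of_pos ht0, div_eq_mul_inv]
  have h2 : |(rnd ζ t j : ℝ) - t * ζ j| ≤ 1 := by
    rw [abs_sub_comm]
    exact (abs_sub_round _).trans (by norm_num)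
  have : (0 : ℝ) ≤ (t : ℝ)⁻¹ := by positivity
  nlinarith

lemma inv_isBigO_one : (fun t : ℕ => ((t : ℝ))⁻¹) =O[Filter.atTop] (fun _ : ℕ => (1 : ℝ)) :=
  (tendsto_inv_atTop_nhds_zero_nat (𝕜 := ℝ)).isBigO_one ℝ

lemma eval_scaled_isBigO (ζ : Fin d → ℝ) (Q : MvPolynomial (Fin d) ℂ) :
    (fun t : ℕ => MvPolynomial.eval (fun j => ((rnd ζ t j : ℤ) : ℂ) / (t : ℂ)) Q
        - MvPolynomial.eval (fun j => (ζ j : ℂ)) Q)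
      =O[Filter.atTop] (fun t : ℕ => ((t : ℝ))⁻¹) := by
  induction Q using MvPolynomial.induction_on with
  | C a => simpa using Asymptotics.isBigO_zero _ _
  | add p q hp hq =>
    refine (hp.add hq).congr_left fun t => ?_
    simp only [map_add]; ring
  | mul_X p j hp =>
    have hj := rnd_scaled_isBigO ζ j
    have hj1 := (hj.trans inv_isBigO_one).add
      (Asymptotics.isBigO_const_const (ζ j : ℂ) (one_ne_zero (α := ℝ)) Filter.atTop)
    have h1 := hp.mul hj1
    have h2 := hj.const_mul_left (MvPolynomial.eval (fun j => (ζ j : ℂ)) p)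
    simp only [mul_one] at h1
    refine (h1.add h2).congr_left fun t => ?_
    simp only [map_mul, MvPolynomial.eval_X]; ring

lemma eval_homog (Q : MvPolynomial (Fin d) ℂ) (k : ℕ) (ζ : Fin d → ℝ) (t : ℕ) (ht : 1 ≤ t) :
    MvPolynomial.eval (fun j => ((rnd ζ t j : ℤ) : ℂ)) (MvPolynomial.homogeneousComponent k Q)
      = (t : ℂ) ^ k * MvPolynomial.eval (fun j => ((rnd ζ t j : ℤ) : ℂ) / (t : ℂ))
        (MvPolynomial.homogeneousComponent k Q) := by
  have ht0 : (t : ℂ) ≠ 0 := by exact_mod_cast (by omega : t ≠ 0)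
  have h := (MvPolynomial.homogeneousComponent_isHomogeneous k Q)
  rw [MvPolynomial.eval_eq', MvPolynomial.eval_eq', Finset.mul_sum]
  refine Finset.sum_congr rfl fun α hα => ?_
  have hd := h (MvPolynomial.mem_support_iff.1 hα)
  have hk : ∑ j, α j = k := by
    rw [← hd, Finsupp.weight_apply, Finsupp.sum_fintype _ _ (by simp)]
    simp
  rw [← hk, ← Finset.prod_pow_eq_pow_sum, mul_left_comm, ← Finset.prod_mul_distrib]
  congr 1
  refine Finset.prod_congr rfl fun j _ => ?_
  rw [← mul_pow, mul_div_cancel₀ _ ht0]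

lemma pow_isBigO_pow {k l : ℕ} (h : k ≤ l) :
    (fun t : ℕ => (t : ℂ) ^ k) =O[Filter.atTop] (fun t : ℕ => (t : ℝ) ^ l) := by
  refine Asymptotics.IsBigO.of_bound 1 ?_
  filter_upwards [Filter.eventually_ge_atTop 1] with t ht
  have ht0 : (1 : ℝ) ≤ t := by exact_mod_cast ht
  simp only [norm_pow, Complex.norm_natCast, one_mul, Real.norm_natCast]
  exact pow_le_pow_right₀ ht0 h

lemma symb_isBigO (m : ℕ) (hm : 1 ≤ m) (P : MvPolynomial (Fin d) ℂ) (hdeg : P.totalDegree ≤ m)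
    (ζ : Fin d → ℝ)
    (hzero : MvPolynomial.eval (fun j => (ζ j : ℂ))
      (MvPolynomial.homogeneousComponent m P) = 0) (lam : ℂ) :
    (fun t : ℕ => symbZ P (rnd ζ t) - lam) =O[Filter.atTop] (fun t : ℕ => (t : ℝ) ^ (m - 1)) := by
  have hlam : (fun _ : ℕ => lam) =O[Filter.atTop] (fun t : ℕ => (t : ℝ) ^ (m - 1)) := by
    have := (pow_isBigO_pow (Nat.zero_le (m - 1))).const_mul_left lam
    simpa using this
  refine Asymptotics.IsBigO.sub ?_ hlam
  have hP : P = ∑ k ∈ Finset.range (m + 1), MvPolynomial.homogeneousComponent k P := by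
    conv_lhs => rw [← MvPolynomial.sum_homogeneousComponent P]
    refine Finset.sum_subset (Finset.range_mono (by omega)) fun k _ hk => ?_
    apply MvPolynomial.homogeneousComponent_eq_zero
    simp at hk; omega
  have hS : (fun t : ℕ => symbZ P (rnd ζ t)) = fun t : ℕ => ∑ k ∈ Finset.range (m + 1),
      MvPolynomial.eval (fun j => ((rnd ζ t j : ℤ) : ℂ))
        (MvPolynomial.homogeneousComponent k P) := by
    funext t
    unfold symbZ
    conv_lhs => rw [hP]
    rw [map_sum]
  rw [hS]
  refine Asymptotics.IsBigO.fun_sum fun k hk => ?_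
  have hev : (fun t : ℕ => MvPolynomial.eval (fun j => ((rnd ζ t j : ℤ) : ℂ))
        (MvPolynomial.homogeneousComponent k P)) =ᶠ[Filter.atTop]
      (fun t : ℕ => (t : ℂ) ^ k * MvPolynomial.eval (fun j => ((rnd ζ t j : ℤ) : ℂ) / (t : ℂ))
        (MvPolynomial.homogeneousComponent k P)) := by
    filter_upwards [Filter.eventually_ge_atTop 1] with t ht using eval_homog P k ζ t ht
  refine hev.trans_isBigO ?_
  have hb := eval_scaled_isBigO ζ (MvPolynomial.homogeneousComponent k P)
  by_cases hkm : k = m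
  · subst hkm
    rw [hzero] at hb
    simp only [sub_zero] at hb
    have h := (pow_isBigO_pow (le_refl k)).mul hb
    refine h.congr' Filter.EventuallyEq.rfl ?_
    filter_upwards [Filter.eventually_ge_atTop 1] with t ht
    have ht0 : (t : ℝ) ≠ 0 := by exact_mod_cast (by omega : t ≠ 0)
    obtain ⟨l, rfl⟩ : ∃ l, k = l + 1 := ⟨k - 1, by omega⟩
    simp only [add_tsub_cancel_right, pow_succ]
    field_simp
  · have hk' : k ≤ m - 1 := by
      simp at hk; omega
    have hb1 := (hb.trans inv_isBigO_one).add
      (Asymptotics.isBigO_const_const (MvPolynomial.eval (fun j => (ζ j : ℂ))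
        (MvPolynomial.homogeneousComponent k P)) (one_ne_zero (α := ℝ)) Filter.atTop)
    simp only [sub_add_cancel] at hb1
    simpa using (pow_isBigO_pow hk').mul hb1

lemma znorm_lower (ζ : Fin d → ℝ) (hζ : ζ ≠ 0) :
    ∃ c : ℝ, 0 < c ∧ ∀ᶠ t : ℕ in Filter.atTop, c * t ≤ znorm (rnd ζ t) := by
  obtain ⟨j, hj⟩ := Function.ne_iff.1 hζ
  have hj0 : 0 < |ζ j| := abs_pos.2 hj
  refine ⟨|ζ j| / 2, by positivity, ?_⟩
  obtain ⟨N, hN⟩ := exists_nat_ge (1 / |ζ j|)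
  filter_upwards [Filter.eventually_ge_atTop N] with t ht
  have h1 : 1 ≤ |ζ j| * t := by
    have : 1 / |ζ j| ≤ (t : ℝ) := hN.trans (by exact_mod_cast ht)
    rwa [div_le_iff₀ hj0, mul_comm] at this
  have h2 : |(t : ℝ) * ζ j - (rnd ζ t j : ℝ)| ≤ 1 / 2 := abs_sub_round _
  have h3 : |(rnd ζ t j : ℝ)| ≤ znorm (rnd ζ t) := by
    unfold znorm
    apply Real.abs_le_sqrt
    exact Finset.single_le_sum (f := fun j => (rnd ζ t j : ℝ) ^ 2)
      (fun i _ => sq_nonneg _) (Finset.mem_univ j)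
  have h4 := abs_sub_abs_le_abs_sub ((t : ℝ) * ζ j) (rnd ζ t j : ℝ)
  rw [abs_mul, Nat.abs_cast] at h4
  linarith

/-- non-ellipticity implies infinitely many solutions: if the
principal part `σ = Σ_{|α|=m} c_α ξ^α` of the degree-`m ≥ 1` polynomial `P` has a zero
`ζ ∈ ℝ^d \ {0}`, then for every `λ ∈ ℂ` and `δ ∈ (0,1)` the set
`{ξ ∈ ℤ^d : |P(ξ) − λ| ≤ |ξ|^{m−1+δ}}` is infinite. -/
theorem statement15
    (d m : ℕ) (hm : 1 ≤ m)
    (P : MvPolynomial (Fin d) ℂ) (hdeg : P.totalDegree ≤ m)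
    (ζ : Fin d → ℝ) (hζ : ζ ≠ 0)
    (hzero : MvPolynomial.eval (fun j => (ζ j : ℂ))
      (MvPolynomial.homogeneousComponent m P) = 0)
    (lam : ℂ) (δ : ℝ) (hδ : δ ∈ Set.Ioo (0 : ℝ) 1) :
    {ξ : Fin d → ℤ | ‖symbZ P ξ - lam‖ ≤ znorm ξ ^ ((m : ℝ) - 1 + δ)}.Infinite := by
  obtain ⟨c, hc, hlow⟩ := znorm_lower ζ hζ
  obtain ⟨C, hC⟩ := (symb_isBigO m hm P hdeg ζ hzero lam).bound
  have he : 0 ≤ (m : ℝ) - 1 + δ := by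
    have : (1 : ℝ) ≤ m := by exact_mod_cast hm
    linarith [hδ.1]
  have hmem : ∀ᶠ t : ℕ in Filter.atTop,
      ‖symbZ P (rnd ζ t) - lam‖ ≤ znorm (rnd ζ t) ^ ((m : ℝ) - 1 + δ) := by
    have htend : Filter.Tendsto (fun t : ℕ => c ^ ((m : ℝ) - 1 + δ) * (t : ℝ) ^ δ)
        Filter.atTop Filter.atTop :=
      ((_root_.tendsto_rpow_atTop hδ.1).comp tendsto_natCast_atTop_atTop).const_mul_atTop
        (Real.rpow_pos_of_pos hc _)
    filter_upwards [hC, hlow, htend.eventually_ge_atTop C, Filter.eventually_ge_atTop 1]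
      with t h1 h2 h3 h4
    have ht0 : (0 : ℝ) < t := by exact_mod_cast h4
    refine h1.trans (le_trans ?_ (Real.rpow_le_rpow (by positivity) h2 he))
    rw [Real.mul_rpow hc.le ht0.le, Real.rpow_add ht0, norm_pow, Real.norm_natCast]
    have hp : (t : ℝ) ^ ((m : ℝ) - 1) = (t : ℝ) ^ (m - 1) := by
      rw [← Real.rpow_natCast, Nat.cast_sub hm, Nat.cast_one]
    rw [hp, mul_left_comm, mul_comm]
    exact mul_le_mul_of_nonneg_left h3 (by positivity)
  intro hfin
  obtain ⟨B, hB⟩ := (hfin.image znorm).bddAbove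
  have ht2 : Filter.Tendsto (fun t : ℕ => c * (t : ℝ)) Filter.atTop Filter.atTop :=
    tendsto_natCast_atTop_atTop.const_mul_atTop hc
  obtain ⟨t, h1, h2, h3⟩ := (hmem.and (hlow.and (ht2.eventually_gt_atTop B))).exists
  have := hB (Set.mem_image_of_mem znorm (show rnd ζ t ∈ _ from h1))
  linarith

end
end

section
/- Let σ(ξ) = Σ_{|α|=m} c_α ξ^α be a homogeneous polynomial of degree m ≥ 1 on ℝ^d with complex coefficients, and suppose there exists ζ ∈ ℝ^d \ {0} with σ(ζ) = 0. Then there exist a constant C > 0 and a sequence (ξ_j)_{j≥0} of lattice points ξ_j ∈ ℤ^d such that |ξ_j| → +∞ as j → +∞ and |σ(ξ_j)| ≤ C (1 + |ξ_j|)^{m−1} for all j. -/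
open MeasureTheory Metric Complex Finset ENNReal NNReal

noncomputable section

variable {d : ℕ}

theorem MvPolynomial.IsHomogeneous.eval_smul_aux {d m : ℕ} {σ : MvPolynomial (Fin d) ℂ}
    (hσ : σ.IsHomogeneous m) (c : ℂ) (y : Fin d → ℂ) :
    MvPolynomial.eval (c • y) σ = c ^ m * MvPolynomial.eval y σ := by
  rw [MvPolynomial.eval_eq, MvPolynomial.eval_eq, Finset.mul_sum]
  refine Finset.sum_congr rfl fun α hα => ?_
  have h : ∑ i ∈ α.support, α i = m := by
    have h0 := hσ (MvPolynomial.mem_support_iff.1 hα)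
    simpa [Finsupp.weight_apply, Finsupp.sum] using h0
  simp only [Pi.smul_apply, smul_eq_mul, mul_pow, Finset.prod_mul_distrib]
  rw [Finset.prod_pow_eq_pow_sum, h]
  ring

/-- if a homogeneous polynomial `σ` of degree `m ≥ 1` on `ℝ^d` has a
real zero `ζ ≠ 0`, then there are `C > 0` and a sequence of lattice points `ξ_j ∈ ℤ^d`
with `|ξ_j| → ∞` and `|σ(ξ_j)| ≤ C (1+|ξ_j|)^{m−1}` for all `j`. -/
theorem statement16
    (d m : ℕ) (hm : 1 ≤ m)
    (σ : MvPolynomial (Fin d) ℂ) (hσ : σ.IsHomogeneous m)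
    (ζ : Fin d → ℝ) (hζ : ζ ≠ 0)
    (hzero : MvPolynomial.eval (fun j => (ζ j : ℂ)) σ = 0) :
    ∃ C : ℝ, 0 < C ∧ ∃ ξ : ℕ → (Fin d → ℤ),
      Filter.Tendsto (fun j => znorm (ξ j)) Filter.atTop Filter.atTop ∧
      ∀ j, ‖MvPolynomial.eval (fun i => ((ξ j i : ℤ) : ℂ)) σ‖ ≤
        C * (1 + znorm (ξ j)) ^ ((m : ℝ) - 1) := by
  have hd : DifferentiableAt ℂ (fun x : Fin d → ℂ => MvPolynomial.eval x σ)
      (fun j => (ζ j : ℂ)) :=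
    (AnalyticOnNhd.eval_mvPolynomial (𝕜 := ℂ) σ _ (Set.mem_univ _)).differentiableAt
  obtain ⟨K, hK, hO⟩ := hd.isBigO_sub.exists_pos
  rw [Asymptotics.IsBigOWith, Metric.eventually_nhds_iff] at hO
  obtain ⟨ε, hε, hO⟩ := hO
  obtain ⟨k, hk⟩ : ∃ k, ζ k ≠ 0 := by
    by_contra! h
    exact hζ (funext h)
  have ha : 0 < |ζ k| := abs_pos.mpr hk
  obtain ⟨T, hT⟩ := exists_nat_gt (1 / ε)
  have hTpos : (0 : ℝ) < T := lt_trans (by positivity) hT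
  let t : ℕ → ℝ := fun j => (j : ℝ) + T
  have ht : ∀ j, (T : ℝ) ≤ t j := fun j => le_add_of_nonneg_left (Nat.cast_nonneg j)
  let ξ : ℕ → Fin d → ℤ := fun j i => round (t j * ζ i)
  have hlow : ∀ j, t j * |ζ k| ≤ 1 + znorm (ξ j) := by
    intro j
    have h1 : |(ξ j k : ℝ)| ≤ znorm (ξ j) := by
      rw [znorm, ← Real.sqrt_sq_eq_abs]
      exact Real.sqrt_le_sqrt (Finset.single_le_sum (f := fun i => ((ξ j i : ℝ)) ^ 2)
        (fun i _ => sq_nonneg _) (Finset.mem_univ k))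
    have h2 : |t j * ζ k - (ξ j k : ℝ)| ≤ 1 / 2 := abs_sub_round _
    have h3 := abs_sub_abs_le_abs_sub (t j * ζ k) (ξ j k : ℝ)
    rw [abs_mul, abs_of_pos (hTpos.trans_le (ht j))] at h3
    linarith
  refine ⟨K * (1 / |ζ k|) ^ (m - 1), by positivity, ξ, ?_, ?_⟩
  · have : Filter.Tendsto (fun j : ℕ => t j * |ζ k| - 1) Filter.atTop Filter.atTop :=
      Filter.tendsto_atTop_add_const_right _ _
        ((Filter.tendsto_atTop_add_const_right _ _
          tendsto_natCast_atTop_atTop).atTop_mul_const ha)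
    exact Filter.tendsto_atTop_mono (fun j => by linarith [hlow j]) this
  · intro j
    have htj : 0 < t j := hTpos.trans_le (ht j)
    have hz : 0 ≤ znorm (ξ j) := Real.sqrt_nonneg _
    let y : Fin d → ℂ := fun i => (ξ j i : ℂ) / (t j : ℂ)
    have htc : (t j : ℂ) ≠ 0 := by exact_mod_cast htj.ne'
    have hdist : ‖y - (fun i => (ζ i : ℂ))‖ ≤ 1 / t j := by
      refine (pi_norm_le_iff_of_nonneg (by positivity)).2 fun i => ?_
      have h2 : |t j * ζ i - (ξ j i : ℝ)| ≤ 1 / 2 := abs_sub_round _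
      have e : (y - (fun i => (ζ i : ℂ))) i = (((ξ j i : ℝ) - t j * ζ i) / t j : ℝ) := by
        simp only [y, Pi.sub_apply]
        push_cast
        field_simp
      rw [e, Complex.norm_real, Real.norm_eq_abs, abs_div, abs_of_pos htj, abs_sub_comm]
      gcongr
      linarith
    have hlt : 1 / t j < ε := by
      rw [div_lt_iff₀ htj]
      rw [div_lt_iff₀ hε] at hT
      nlinarith [ht j]
    have hb := hO (y := y) (by rw [dist_eq_norm]; exact hdist.trans_lt hlt)
    rw [hzero, sub_zero] at hb
    have hsc : MvPolynomial.eval (fun i => ((ξ j i : ℤ) : ℂ)) σ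
        = (t j : ℂ) ^ m * MvPolynomial.eval y σ := by
      rw [← hσ.eval_smul_aux]
      congr 2
      funext i
      simp only [y, Pi.smul_apply, smul_eq_mul]
      field_simp
    obtain ⟨n, rfl⟩ : ∃ n, m = n + 1 := ⟨m - 1, by omega⟩
    have hexp : (((n + 1 : ℕ) : ℝ) - 1) = (n : ℝ) := by push_cast; ring
    rw [hexp, Real.rpow_natCast, hsc, norm_mul, norm_pow, Complex.norm_real, Real.norm_eq_abs,
      abs_of_pos htj, Nat.add_sub_cancel]
    calc t j ^ (n + 1) * ‖MvPolynomial.eval y σ‖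
        ≤ t j ^ (n + 1) * (K * (1 / t j)) := by
          gcongr
          exact hb.trans (by gcongr)
      _ = K * t j ^ n := by rw [pow_succ]; field_simp
      _ ≤ K * ((1 / |ζ k|) * (1 + znorm (ξ j))) ^ n := by
          gcongr
          rw [one_div, inv_mul_eq_div, le_div_iff₀ ha]
          exact hlow j
      _ = _ := by rw [mul_pow, mul_assoc]

end
end
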